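/- arXiv:2303.03690 — 2 statements merged into one kernel-verified Lean document; each statement's English description precedes it below -/
import Mathlib

section
/- (Unique solvability, Theorem 2.1.) Let g ≥ 0, ε > 0, f(u) := u³ − g u² − ε u, and let a₀ > 0 satisfy a₀ > ε + 4g²/3. Then for every G ∈ V_h there exists a unique w ∈ V_h such that a₀ w + (1+Δ_h)² w + f(w) = G (where f acts pointwise). Consequently, if the maximum time step satisfies τ^α < 3/(Γ(2−α)(4g² + 3ε)), then at each time level n the variable-step L1 scheme D_τ^α u^n = −(1+Δ_h)² u^n − f(u^n) has a unique solution u^n ∈ V_h given u⁰, …, u^{n−1}. -/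
open scoped BigOperators

/-- ω_β(t) = t^{β-1}/Γ(β) -/
noncomputable def omegaK (β t : ℝ) : ℝ := t ^ (β - 1) / Real.Gamma β

/-- variable-step L1 kernel: `aK α t n k = a^{(n)}_{n-k}` for `1 ≤ k ≤ n`. -/
noncomputable def aK (α : ℝ) (t : ℕ → ℝ) (n k : ℕ) : ℝ :=
  (1 / (t k - t (k - 1))) * ∫ s in (t (k - 1))..(t k), omegaK (1 - α) (t n - s)

/-- DCC kernel: `pK α t n m = p^{(n)}_m`, i.e. `p^{(n)}_{n-k} = pK α t n (n-k)`;
`p^{(n)}_0 = 1/a^{(n)}_0` and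
`p^{(n)}_{n-k} = (1/a^{(k)}_0) Σ_{j=k+1}^n (a^{(j)}_{j-k-1} - a^{(j)}_{j-k}) p^{(n)}_{n-j}`. -/
noncomputable def pK (α : ℝ) (t : ℕ → ℝ) (n : ℕ) : ℕ → ℝ
  | 0 => 1 / aK α t n n
  | m + 1 =>
      (1 / aK α t (n - m - 1) (n - m - 1)) *
        ∑ i ∈ (Finset.range (m + 1)).attach,
          (aK α t (n - i.1) (n - m) - aK α t (n - i.1) (n - m - 1)) * pK α t n i.1
  decreasing_by exact Finset.mem_range.mp i.2

/-- discrete Laplacian on `L`-periodic grid functions (indices mod `M`) -/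
noncomputable def dLap (M : ℕ) (h : ℝ) (v : ZMod M → ZMod M → ℝ) : ZMod M → ZMod M → ℝ :=
  fun i j => (v (i + 1) j + v (i - 1) j + v i (j + 1) + v i (j - 1) - 4 * v i j) / h ^ 2

/-- discrete inner product ⟨v,w⟩ = h² Σ_{ij} v_{ij} w_{ij} -/
noncomputable def dInner (M : ℕ) [NeZero M] (h : ℝ) (v w : ZMod M → ZMod M → ℝ) : ℝ :=
  h ^ 2 * ∑ i : ZMod M, ∑ j : ZMod M, v i j * w i j

/-- discrete L² norm -/
noncomputable def dNorm (M : ℕ) [NeZero M] (h : ℝ) (v : ZMod M → ZMod M → ℝ) : ℝ :=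
  Real.sqrt (dInner M h v v)

/-- the operator (1+Δ_h) -/
noncomputable def opA (M : ℕ) (h : ℝ) (v : ZMod M → ZMod M → ℝ) : ZMod M → ZMod M → ℝ :=
  v + dLap M h v

/-- pointwise nonlinearity f(u) = u³ - g u² - ε u -/
noncomputable def fPt (g ε : ℝ) (M : ℕ) (v : ZMod M → ZMod M → ℝ) : ZMod M → ZMod M → ℝ :=
  fun i j => (v i j) ^ 3 - g * (v i j) ^ 2 - ε * v i j

/-- discrete energy E[v] = ½‖(1+Δ_h)v‖² + ¼‖v‖₄⁴ - (g/3)⟨v²,v⟩ - (ε/2)‖v‖² -/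
noncomputable def dEnergy (M : ℕ) [NeZero M] (h g ε : ℝ) (v : ZMod M → ZMod M → ℝ) : ℝ :=
  (1 / 2) * dInner M h (opA M h v) (opA M h v)
    + (1 / 4) * (h ^ 2 * ∑ i : ZMod M, ∑ j : ZMod M, |v i j| ^ 4)
    - (g / 3) * dInner M h (fun i j => (v i j) ^ 2) v
    - (ε / 2) * dInner M h v v

lemma opA_lin (M : ℕ) (h : ℝ) (v w : ZMod M → ZMod M → ℝ) (s : ℝ) (i j : ZMod M) :
    opA M h (w + s • v) i j = opA M h w i j + s * opA M h v i j := by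
  simp only [opA, dLap, Pi.add_apply, Pi.smul_apply, smul_eq_mul]
  ring

lemma opA_sub (M : ℕ) (h : ℝ) (v w : ZMod M → ZMod M → ℝ) :
    opA M h (w - v) = opA M h w - opA M h v := by
  funext i j
  simp only [opA, dLap, Pi.add_apply, Pi.sub_apply]
  ring

lemma opA_symm (M : ℕ) [NeZero M] (h : ℝ) (v w : ZMod M → ZMod M → ℝ) :
    ∑ i, ∑ j, opA M h v i j * w i j = ∑ i, ∑ j, v i j * opA M h w i j := by
  have e1 : ∀ v w : ZMod M → ZMod M → ℝ,
      ∑ i, ∑ j, v (i + 1) j * w i j = ∑ i, ∑ j, v i j * w (i - 1) j := by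
    intro v w
    rw [← Equiv.sum_comp (Equiv.addRight (1 : ZMod M)) (fun i => ∑ j, v i j * w (i - 1) j)]
    simp
  have e2 : ∀ v w : ZMod M → ZMod M → ℝ,
      ∑ i, ∑ j, v i (j + 1) * w i j = ∑ i, ∑ j, v i j * w i (j - 1) := by
    intro v w
    refine Finset.sum_congr rfl fun i _ => ?_
    rw [← Equiv.sum_comp (Equiv.addRight (1 : ZMod M)) (fun j => v i j * w i (j - 1))]
    simp
  have key : ∀ v w : ZMod M → ZMod M → ℝ, ∑ i, ∑ j, opA M h v i j * w i j =
      ∑ i, ∑ j, v i j * w i j + (1 / h ^ 2) * (∑ i, ∑ j, v (i + 1) j * w i j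
        + ∑ i, ∑ j, w i j * v (i - 1) j + ∑ i, ∑ j, v i (j + 1) * w i j
        + ∑ i, ∑ j, w i j * v i (j - 1) - 4 * ∑ i, ∑ j, v i j * w i j) := by
    intro v w
    simp only [Finset.mul_sum, ← Finset.sum_add_distrib, ← Finset.sum_sub_distrib]
    refine Finset.sum_congr rfl fun i _ => Finset.sum_congr rfl fun j _ => ?_
    simp only [opA, dLap, Pi.add_apply]
    ring
  have c : ∑ i, ∑ j, v i j * opA M h w i j = ∑ i, ∑ j, opA M h w i j * v i j := by
    simp only [mul_comm]
  have c0 : ∑ i, ∑ j, w i j * v i j = ∑ i, ∑ j, v i j * w i j := by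
    simp only [mul_comm]
  rw [c, key v w, key w v, e1 v w, e1 w v, e2 v w, e2 w v, c0]
  ring

lemma sum2_eq_zero (M : ℕ) [NeZero M] (F : ZMod M → ZMod M → ℝ) (hF : ∀ i j, 0 ≤ F i j)
    (h0 : ∑ i, ∑ j, F i j ≤ 0) (i j : ZMod M) : F i j ≤ 0 := by
  have h1 : F i j ≤ ∑ j, F i j :=
    Finset.single_le_sum (f := fun j => F i j) (fun j _ => hF i j) (Finset.mem_univ j)
  have h2 : ∑ j, F i j ≤ ∑ i, ∑ j, F i j :=
    Finset.single_le_sum (f := fun i => ∑ j, F i j)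
      (fun i _ => Finset.sum_nonneg fun j _ => hF i j) (Finset.mem_univ i)
  linarith

/-- the convex functional whose critical points solve the nonlinear system -/
noncomputable def Jf (M : ℕ) [NeZero M] (h g ε a : ℝ) (G w : ZMod M → ZMod M → ℝ) : ℝ :=
  ∑ i, ∑ j, ((1 / 2) * opA M h w i j ^ 2 + ((1 / 4) * w i j ^ 4 - (g / 3) * w i j ^ 3
    + ((a - ε) / 2) * w i j ^ 2) - G i j * w i j)

lemma Jf_cont (M : ℕ) [NeZero M] (h g ε a : ℝ) (G : ZMod M → ZMod M → ℝ) :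
    Continuous (Jf M h g ε a G) := by
  unfold Jf opA dLap
  simp only [Pi.add_apply]
  fun_prop

lemma Jf_min (M : ℕ) [NeZero M] (h g ε a : ℝ) (ha : a > ε + 4 * g ^ 2 / 3)
    (G : ZMod M → ZMod M → ℝ) : ∃ w, ∀ v, Jf M h g ε a G w ≤ Jf M h g ε a G v := by
  have J0 : Jf M h g ε a G 0 = 0 := by
    simp [Jf, opA, dLap]
  set δ := a - ε - 2 * g ^ 2 / 9 with hδ
  have hδ0 : 0 < δ := by nlinarith [sq_nonneg g]
  set C := ∑ i, ∑ j, G i j ^ 2 / δ with hC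
  have lower : ∀ w, Jf M h g ε a G w ≤ 0 → ∀ i j, δ / 4 * w i j ^ 2 ≤ C := by
    intro w hw i j
    have hC' : ∀ i j, 0 ≤ G i j ^ 2 / δ := fun i j => by positivity
    have hle : ∑ i, ∑ j, (δ / 4 * w i j ^ 2 - G i j ^ 2 / δ) ≤ Jf M h g ε a G w := by
      unfold Jf
      refine Finset.sum_le_sum fun i _ => Finset.sum_le_sum fun j _ => ?_
      have h1 : 0 ≤ (w i j ^ 2 / 2 - g * w i j / 3) ^ 2 := sq_nonneg _
      have h2 : 0 ≤ (δ / 2 * w i j - G i j) ^ 2 / δ := by positivity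
      have h3 : (δ / 2 * w i j - G i j) ^ 2 / δ
          = δ / 4 * w i j ^ 2 - G i j * w i j + G i j ^ 2 / δ := by
        field_simp
        ring
      have h4 : 0 ≤ opA M h w i j ^ 2 := sq_nonneg _
      have h5 : ((1 / 4) * w i j ^ 4 - (g / 3) * w i j ^ 3 + ((a - ε) / 2) * w i j ^ 2)
          = (w i j ^ 2 / 2 - g * w i j / 3) ^ 2 + δ / 2 * w i j ^ 2 := by
        rw [hδ]; ring
      rw [h5]
      linarith
    simp only [Finset.sum_sub_distrib] at hle
    have h1 : δ / 4 * w i j ^ 2 ≤ ∑ j, δ / 4 * w i j ^ 2 :=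
      Finset.single_le_sum (f := fun j => δ / 4 * w i j ^ 2) (fun j _ => by positivity)
        (Finset.mem_univ j)
    have h2 : ∑ j, δ / 4 * w i j ^ 2 ≤ ∑ i, ∑ j, δ / 4 * w i j ^ 2 :=
      Finset.single_le_sum (f := fun i => ∑ j, δ / 4 * w i j ^ 2)
        (fun i _ => Finset.sum_nonneg fun j _ => by positivity) (Finset.mem_univ i)
    linarith
  have hcl : IsClosed {w | Jf M h g ε a G w ≤ 0} :=
    isClosed_le (Jf_cont M h g ε a G) continuous_const
  have hC0 : 0 ≤ C := Finset.sum_nonneg fun i _ => Finset.sum_nonneg fun j _ => by positivity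
  have hbd : Bornology.IsBounded {w | Jf M h g ε a G w ≤ 0} := by
    refine (Metric.isBounded_closedBall (x := (0 : ZMod M → ZMod M → ℝ))
      (r := 1 + 4 * C / δ)).subset ?_
    intro w hw
    have hr : 0 ≤ 1 + 4 * C / δ := by positivity
    rw [mem_closedBall_zero_iff, pi_norm_le_iff_of_nonneg hr]
    intro i
    rw [pi_norm_le_iff_of_nonneg hr]
    intro j
    have h1 := lower w hw i j
    have h2 : w i j ^ 2 ≤ 4 * C / δ := by
      rw [le_div_iff₀ hδ0]; linarith
    rw [Real.norm_eq_abs]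
    nlinarith [sq_abs (w i j), sq_nonneg (|w i j| - 1), abs_nonneg (w i j)]
  have hK := Metric.isCompact_of_isClosed_isBounded hcl hbd
  obtain ⟨w, hw, hmin⟩ := hK.exists_isMinOn ⟨0, by simp [J0]⟩ (Jf_cont M h g ε a G).continuousOn
  refine ⟨w, fun v => ?_⟩
  by_cases hv : Jf M h g ε a G v ≤ 0
  · exact hmin hv
  · exact le_trans hw (not_le.mp hv).le

lemma Jf_deriv (M : ℕ) [NeZero M] (h g ε a : ℝ) (G w v : ZMod M → ZMod M → ℝ) :
    HasDerivAt (fun s : ℝ => Jf M h g ε a G (w + s • v))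
      (∑ i, ∑ j, (opA M h w i j * opA M h v i j + (w i j ^ 3 - g * w i j ^ 2
        + (a - ε) * w i j - G i j) * v i j)) 0 := by
  unfold Jf
  simp only [opA_lin]
  refine HasDerivAt.fun_sum fun i _ => HasDerivAt.fun_sum fun j _ => ?_
  have hl : ∀ p q : ℝ, HasDerivAt (fun s : ℝ => p + s * q) q 0 := by
    intro p q
    simpa using ((hasDerivAt_id (0 : ℝ)).mul_const q).const_add p
  have hA := hl (opA M h w i j) (opA M h v i j)
  have hx := hl (w i j) (v i j)
  simp only [Pi.add_apply, Pi.smul_apply, smul_eq_mul]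
  convert (((hA.fun_pow 2).const_mul (1 / 2)).fun_add ((((hx.fun_pow 4).const_mul (1 / 4)).fun_sub
    ((hx.fun_pow 3).const_mul (g / 3))).fun_add ((hx.fun_pow 2).const_mul ((a - ε) / 2)))).fun_sub
    (hx.const_mul (G i j)) using 1
  norm_num
  ring

lemma part_one (M : ℕ) [NeZero M] (h g ε a : ℝ) (ha : a > ε + 4 * g ^ 2 / 3)
    (G : ZMod M → ZMod M → ℝ) :
    ∃! w : ZMod M → ZMod M → ℝ, a • w + opA M h (opA M h w) + fPt g ε M w = G := by
  obtain ⟨w, hw⟩ := Jf_min M h g ε a ha G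
  have hw' : a • w + opA M h (opA M h w) + fPt g ε M w = G := by
    set R := a • w + opA M h (opA M h w) + fPt g ε M w - G with hR
    have hd := Jf_deriv M h g ε a G w R
    have hmin : IsLocalMin (fun s : ℝ => Jf M h g ε a G (w + s • R)) 0 :=
      Filter.Eventually.of_forall fun s => by simpa using hw (w + s • R)
    have h0 := hmin.hasDerivAt_eq_zero hd
    have h1 : ∑ i, ∑ j, R i j ^ 2 = 0 := by
      rw [← h0]
      simp only [Finset.sum_add_distrib]
      rw [← opA_symm M h (opA M h w) R]
      simp only [← Finset.sum_add_distrib]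
      refine Finset.sum_congr rfl fun i _ => Finset.sum_congr rfl fun j _ => ?_
      have : R i j = a * w i j + opA M h (opA M h w) i j
          + (w i j ^ 3 - g * w i j ^ 2 - ε * w i j) - G i j := rfl
      rw [sq]
      nth_rewrite 1 [this]
      ring
    have h2 : R = 0 := by
      funext i j
      have := sum2_eq_zero M (fun i j => R i j ^ 2) (fun i j => sq_nonneg _) h1.le i j
      exact pow_eq_zero_iff two_ne_zero |>.mp (le_antisymm this (sq_nonneg _))
    exact sub_eq_zero.mp h2
  refine ⟨w, hw', ?_⟩
  · intro v hv
    set d := v - w with hd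
    have hz : ∑ i, ∑ j, ((opA M h d i j) * (opA M h d i j) +
        (a * d i j + (fPt g ε M v i j - fPt g ε M w i j)) * d i j) = 0 := by
      simp only [Finset.sum_add_distrib]
      rw [← opA_symm M h (opA M h d) d]
      simp only [← Finset.sum_add_distrib]
      refine Finset.sum_eq_zero fun i _ => Finset.sum_eq_zero fun j _ => ?_
      have e := congrFun (congrFun (hv.trans hw'.symm) i) j
      simp only [Pi.add_apply, Pi.smul_apply, smul_eq_mul] at e
      rw [hd, opA_sub, opA_sub]
      simp only [Pi.sub_apply]
      linear_combination (v i j - w i j) * e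
    set c := a - ε - g ^ 2 / 3 with hc
    have hc0 : 0 < c := by nlinarith [sq_nonneg g]
    have hle : ∑ i, ∑ j, c * d i j ^ 2 ≤ 0 := by
      rw [← hz]
      refine Finset.sum_le_sum fun i _ => Finset.sum_le_sum fun j _ => ?_
      have hdij : d i j = v i j - w i j := rfl
      simp only [fPt]
      generalize opA M h d i j = q
      rw [hdij]
      generalize v i j = x
      generalize w i j = y
      have k : 0 ≤ x ^ 2 + x * y + y ^ 2 - g * (x + y) + g ^ 2 / 3 := by
        nlinarith [sq_nonneg (x - y), sq_nonneg (3 * (x + y) - 2 * g)]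
      have k2 := mul_nonneg k (sq_nonneg (x - y))
      rw [hc]
      nlinarith [mul_self_nonneg q]
    funext i j
    have := sum2_eq_zero M (fun i j => c * d i j ^ 2) (fun i j => by positivity) hle i j
    have h3 : d i j ^ 2 ≤ 0 := by
      by_contra hn
      push Not at hn
      exact absurd this (not_le.mpr (mul_pos hc0 hn))
    have h4 : d i j = 0 := pow_eq_zero_iff two_ne_zero |>.mp (le_antisymm h3 (sq_nonneg _))
    exact sub_eq_zero.mp h4

lemma aK_diag (α : ℝ) (h0 : 0 < α) (h1 : α < 1) (t : ℕ → ℝ) (n : ℕ) (hn : t (n - 1) < t n) :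
    aK α t n n = 1 / ((t n - t (n - 1)) ^ α * Real.Gamma (2 - α)) := by
  unfold aK omegaK
  set τ := t n - t (n - 1) with hτ
  have hτ0 : 0 < τ := by linarith
  rw [intervalIntegral.integral_comp_sub_left
    (fun x => x ^ (1 - α - 1) / Real.Gamma (1 - α)) (t n)]
  rw [intervalIntegral.integral_div, sub_self, ← hτ, integral_rpow (Or.inl (by linarith))]
  have hG : Real.Gamma (2 - α) = (1 - α) * Real.Gamma (1 - α) := by
    rw [← Real.Gamma_add_one (by linarith)]
    congr 1
    ring
  have hGp : 0 < Real.Gamma (1 - α) := Real.Gamma_pos_of_pos (by linarith)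
  have e : 1 - α - 1 + 1 = 1 - α := by ring
  have h1' : 0 < 1 - α := by linarith
  have hp : 0 < τ ^ α := Real.rpow_pos_of_pos hτ0 _
  rw [hG, e, Real.zero_rpow h1'.ne', Real.rpow_sub hτ0, Real.rpow_one]
  field_simp
  ring

/-- Theorem 2.1, unique solvability: (i) for `a₀ > ε + 4g²/3`, the map
`w ↦ a₀ w + (1+Δ_h)² w + f(w)` hits every `G ∈ V_h` exactly once; (ii) consequently,
if `τ^α < 3/(Γ(2-α)(4g²+3ε))` then the variable-step L1 scheme
`D_τ^α uⁿ = -(1+Δ_h)² uⁿ - f(uⁿ)` has a unique solution `uⁿ` given `u⁰,…,u^{n-1}`. -/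
theorem unique_solvability
    (L : ℝ) (hL : 0 < L) (M : ℕ) [NeZero M] (hM : 2 ≤ M)
    (g ε : ℝ) (hg : 0 ≤ g) (hε : 0 < ε) :
    (∀ a₀ : ℝ, a₀ > ε + 4 * g ^ 2 / 3 → ∀ G : ZMod M → ZMod M → ℝ,
        ∃! w : ZMod M → ZMod M → ℝ,
          a₀ • w + opA M (L / M) (opA M (L / M) w) + fPt g ε M w = G) ∧
      (∀ (N : ℕ) (α T : ℝ), 0 < α → α < 1 →
        ∀ t : ℕ → ℝ, t 0 = 0 → t N = T → (∀ k, k < N → t k < t (k + 1)) →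
        (∀ k, 1 ≤ k → k ≤ N →
          (t k - t (k - 1)) ^ α < 3 / (Real.Gamma (2 - α) * (4 * g ^ 2 + 3 * ε))) →
        ∀ (u : ℕ → ZMod M → ZMod M → ℝ) (n : ℕ), 1 ≤ n → n ≤ N →
          ∃! w : ZMod M → ZMod M → ℝ,
            (∑ k ∈ Finset.Icc 1 (n - 1), aK α t n k • (u k - u (k - 1)))
                + aK α t n n • (w - u (n - 1))
              = -(opA M (L / M) (opA M (L / M) w) + fPt g ε M w)) := by
  refine ⟨fun a ha G => part_one M (L / M) g ε a ha G, ?_⟩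
  intro N α T h0 h1 t _ _ hmono hτ u n hn hnN
  have hlt : t (n - 1) < t n := by
    have := hmono (n - 1) (by omega)
    rwa [Nat.sub_add_cancel hn] at this
  have hd := aK_diag α h0 h1 t n hlt
  have hG : 0 < Real.Gamma (2 - α) := Real.Gamma_pos_of_pos (by linarith)
  have hp : 0 < (t n - t (n - 1)) ^ α := Real.rpow_pos_of_pos (by linarith) _
  have hq : 0 < 4 * g ^ 2 + 3 * ε := by positivity
  have hs := hτ n hn hnN
  have ha : aK α t n n > ε + 4 * g ^ 2 / 3 := by
    rw [hd, gt_iff_lt, lt_div_iff₀ (by positivity)]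
    rw [lt_div_iff₀ (by positivity)] at hs
    linarith
  obtain ⟨w, hw, huniq⟩ := part_one M (L / M) g ε _ ha
    (aK α t n n • u (n - 1) - ∑ k ∈ Finset.Icc 1 (n - 1), aK α t n k • (u k - u (k - 1)))
  refine ⟨w, ?_, fun v hv => huniq v ?_⟩
  · simp only [smul_sub] at hw ⊢
    linear_combination hw
  · simp only [smul_sub] at hv ⊢
    linear_combination hv
end

section
/- (Discrete fractional Grönwall inequality.) Let ρ > 0 and suppose the maximum step size satisfies τ^α ≤ 1/(2Γ(2−α)ρ). Let v_0, v_1, …, v_N, ξ_1, …, ξ_N, η_1, …, η_N be nonnegative reals satisfying Σ_{k=1}^{n} a^{(n)}_{n−k}(v_k − v_{k−1}) ≤ ρ v_n + ξ_n + η_n for 1 ≤ n ≤ N. Then for every 1 ≤ n ≤ N, v_n ≤ 2 E_α(2ρ t_n^α / r*) ( v_0 + max_{1≤k≤n} Σ_{j=1}^{k} p^{(k)}_{k−j} ξ_j + ω_{1+α}(t_n) max_{1≤j≤n} η_j ), where r* := min_{2≤k≤N} min{1, τ_k/τ_{k−1}} is the minimum step ratio and E_α(z) := Σ_{k=0}^{∞}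 z^k/Γ(1+kα) is the Mittag-Leffler function. -/
open scoped BigOperators

/-- Mittag-Leffler function E_α(z) = Σ_{k≥0} z^k/Γ(1+kα) -/
noncomputable def mittagLeffler (α z : ℝ) : ℝ := ∑' k : ℕ, z ^ k / Real.Gamma (1 + k * α)

/-- minimum step ratio r* = min_{2≤k≤N} min{1, τ_k/τ_{k-1}} -/
noncomputable def minStepRatio (t : ℕ → ℝ) (N : ℕ) : ℝ :=
  sInf (insert 1 ((fun k : ℕ => (t k - t (k - 1)) / (t (k - 1) - t (k - 2))) '' Set.Icc 2 N))

lemma real_beta_scaled (a b x : ℝ) (ha : 0 < a) (hb : 0 < b) (hx : 0 < x) :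
    ∫ s in (0:ℝ)..x, s ^ (b - 1) * (x - s) ^ (a - 1)
      = x ^ (a + b - 1) * (Real.Gamma a * Real.Gamma b / Real.Gamma (a + b)) := by
  have h1 := Complex.betaIntegral_scaled (b : ℂ) (a : ℂ) hx
  have h2 := Complex.betaIntegral_eq_Gamma_mul_div (b : ℂ) (a : ℂ) (by simpa) (by simpa)
  rw [h2] at h1
  have h3 : ∫ s in (0:ℝ)..x, (s : ℂ) ^ ((b : ℂ) - 1) * ((x : ℂ) - s) ^ ((a : ℂ) - 1)
      = ∫ s in (0:ℝ)..x, ((s ^ (b - 1) * (x - s) ^ (a - 1) : ℝ) : ℂ) := by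
    apply intervalIntegral.integral_congr
    intro s hs
    rw [Set.uIcc_of_le hx.le] at hs
    simp only
    rw [Complex.ofReal_mul, Complex.ofReal_cpow hs.1, Complex.ofReal_cpow (by linarith [hs.2])]
    push_cast
    rfl
  rw [h3, intervalIntegral.integral_ofReal] at h1
  have h4 : (x : ℂ) ^ ((b : ℂ) + a - 1) = ((x ^ (a + b - 1) : ℝ) : ℂ) := by
    rw [Complex.ofReal_cpow hx.le]
    push_cast
    congr 1
    ring
  rw [h4, ← Complex.ofReal_add, Complex.Gamma_ofReal, Complex.Gamma_ofReal,
    Complex.Gamma_ofReal] at h1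
  have h5 : (∫ s in (0:ℝ)..x, s ^ (b - 1) * (x - s) ^ (a - 1))
      = x ^ (a + b - 1) * (Real.Gamma b * Real.Gamma a / Real.Gamma (b + a)) := by
    exact_mod_cast h1
  rw [h5, add_comm b a, mul_comm (Real.Gamma b)]

lemma omega_conv (α β x : ℝ) (hα : α < 1) (hβ : 0 < β) (hx : 0 < x) :
    ∫ s in (0:ℝ)..x, omegaK (1 - α) (x - s) * omegaK β s = omegaK (1 - α + β) x := by
  have ha : 0 < 1 - α := by linarith
  have h := real_beta_scaled (1 - α) β x ha hβ hx
  have h1 : (fun s => omegaK (1 - α) (x - s) * omegaK β s) =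
      fun s => (1 / (Real.Gamma (1 - α) * Real.Gamma β)) *
        (s ^ (β - 1) * (x - s) ^ (1 - α - 1)) := by
    funext s
    unfold omegaK
    field_simp
  rw [h1, intervalIntegral.integral_const_mul, h]
  have g1 := Real.Gamma_pos_of_pos ha
  have g2 := Real.Gamma_pos_of_pos hβ
  unfold omegaK
  field_simp

lemma omega_pos (β x : ℝ) (hβ : 0 < β) (hx : 0 < x) : 0 < omegaK β x :=
  div_pos (Real.rpow_pos_of_pos hx _) (Real.Gamma_pos_of_pos hβ)

lemma omega_conv_int (α β x : ℝ) (hα : α < 1) (hβ : 0 < β) (hx : 0 < x) :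
    IntervalIntegrable (fun s => omegaK (1 - α) (x - s) * omegaK β s) MeasureTheory.volume 0 x := by
  apply intervalIntegral.intervalIntegrable_of_integral_ne_zero
  rw [omega_conv α β x hα hβ hx]
  exact (omega_pos _ _ (by linarith) hx).ne'

lemma omega_int (β a b : ℝ) (hβ : 0 < β) :
    IntervalIntegrable (fun s => omegaK β s) MeasureTheory.volume a b := by
  unfold omegaK
  exact (intervalIntegral.intervalIntegrable_rpow' (by linarith)).div_const _

lemma omega_int' (β a b x : ℝ) (hβ : 0 < β) :
    IntervalIntegrable (fun s => omegaK β (x - s)) MeasureTheory.volume a b := by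
  have := (omega_int β (x - a) (x - b) hβ).comp_sub_left x
  simpa using this

lemma omega_integral (β a b : ℝ) (hβ : 0 < β) :
    ∫ s in a..b, omegaK β s = omegaK (β + 1) b - omegaK (β + 1) a := by
  unfold omegaK
  rw [intervalIntegral.integral_div, integral_rpow (Or.inl (by linarith)),
    Real.Gamma_add_one hβ.ne']
  have := Real.Gamma_pos_of_pos hβ
  simp only [sub_add_cancel, add_sub_cancel_right]
  field_simp

lemma omega_anti (β x y : ℝ) (hβ : 0 < β) (hβ1 : β ≤ 1) (hx : 0 < x) (hxy : x ≤ y) :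
    omegaK β y ≤ omegaK β x := by
  unfold omegaK
  have := Real.Gamma_pos_of_pos hβ
  gcongr ?_ / _
  exact Real.rpow_le_rpow_of_nonpos hx hxy (by linarith)

lemma omega_mono (β x y : ℝ) (hβ1 : 1 ≤ β) (hx : 0 ≤ x) (hxy : x ≤ y) :
    omegaK β x ≤ omegaK β y := by
  unfold omegaK
  have := Real.Gamma_pos_of_pos (show 0 < β by linarith)
  gcongr ?_ / _
  exact Real.rpow_le_rpow hx hxy (by linarith)

lemma omega_hasDeriv (β x : ℝ) (hβ : 0 < β) (hx : 0 < x) :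
    HasDerivAt (fun s => omegaK (β + 1) s) (omegaK β x) x := by
  unfold omegaK
  have h := (Real.hasDerivAt_rpow_const (x := x) (p := β + 1 - 1) (Or.inl hx.ne')).div_const
    (Real.Gamma (β + 1))
  have e : (β + 1 - 1) * x ^ (β + 1 - 1 - 1) / Real.Gamma (β + 1)
      = x ^ (β - 1) / Real.Gamma β := by
    rw [Real.Gamma_add_one hβ.ne']
    have := Real.Gamma_pos_of_pos hβ
    simp only [add_sub_cancel_right]
    field_simp
  rw [e] at h
  exact h

lemma omega_cont (β : ℝ) (hβ : 0 < β) : Continuous (fun s => omegaK (β + 1) s) := by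
  unfold omegaK
  refine Continuous.div_const ?_ _
  exact Real.continuous_rpow_const (by linarith)

lemma a_explicit (α : ℝ) (h1 : α < 1) (t : ℕ → ℝ) (n k : ℕ) :
    aK α t n k = (omegaK (1 - α + 1) (t n - t (k - 1)) - omegaK (1 - α + 1) (t n - t k)) /
      (t k - t (k - 1)) := by
  unfold aK
  rw [intervalIntegral.integral_comp_sub_left (fun s => omegaK (1 - α) s),
    omega_integral _ _ _ (by linarith)]
  ring

/-- cell bound, concave case -/
lemma cell_concave (α β x a b : ℝ) (h1 : α < 1) (h0 : 0 < α) (hβ : 0 < β) (hβ1 : β ≤ 1)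
    (ha : 0 ≤ a) (hab : a < b) (hbx : b ≤ x) :
    ∫ s in a..b, omegaK (1 - α) (x - s) * omegaK β s ≤
      ((1 / (b - a)) * ∫ s in a..b, omegaK (1 - α) (x - s)) *
        (omegaK (β + 1) b - omegaK (β + 1) a) := by
  obtain ⟨c, hc, hce⟩ := exists_hasDerivAt_eq_slope (fun s => omegaK (β + 1) s) (omegaK β) hab
    (omega_cont β hβ).continuousOn (fun y hy => omega_hasDeriv β y hβ (by linarith [hy.1]))
  have hI1 : IntervalIntegrable (fun s => omegaK (1 - α) (x - s) * omegaK β s)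
      MeasureTheory.volume a b := by
    refine (omega_conv_int α β x h1 hβ (by linarith)).mono_set ?_
    rw [Set.uIcc_of_le hab.le, Set.uIcc_of_le (by linarith)]
    exact Set.Icc_subset_Icc ha hbx
  have hI2 := omega_int' (1 - α) a b x (by linarith)
  have hI3 := omega_int β a b hβ
  have key : ∫ s in a..b, omegaK (1 - α) (x - s) * omegaK β s ≤
      ∫ s in a..b, (omegaK β c * omegaK (1 - α) (x - s) +
        (omegaK (1 - α) (x - c) * omegaK β s - omegaK (1 - α) (x - c) * omegaK β c)) := by
    refine intervalIntegral.integral_mono_on_of_le_Ioo hab.le hI1 ?_ ?_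
    · exact (hI2.const_mul _).add ((hI3.const_mul _).sub intervalIntegrable_const)
    · intro s hs
      have : (omegaK (1 - α) (x - s) - omegaK (1 - α) (x - c)) * (omegaK β s - omegaK β c) ≤ 0 := by
        rcases le_total s c with h | h
        · have e1 := omega_anti (1 - α) (x - c) (x - s) (by linarith) (by linarith)
            (by linarith [hc.2]) (by linarith)
          have e2 := omega_anti β s c hβ hβ1 (by linarith [hs.1]) h
          exact mul_nonpos_of_nonpos_of_nonneg (by linarith) (by linarith)
        · have e1 := omega_anti (1 - α) (x - s) (x - c) (by linarith) (by linarith)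
            (by linarith [hs.2]) (by linarith)
          have e2 := omega_anti β c s hβ hβ1 (by linarith [hc.1]) h
          exact mul_nonpos_of_nonneg_of_nonpos (by linarith) (by linarith)
      nlinarith [this]
  rw [intervalIntegral.integral_add (hI2.const_mul _)
    ((hI3.const_mul _).sub intervalIntegrable_const),
    intervalIntegral.integral_sub (hI3.const_mul _) intervalIntegrable_const,
    intervalIntegral.integral_const_mul, intervalIntegral.integral_const_mul,
    intervalIntegral.integral_const, omega_integral β a b hβ, hce] at key
  refine key.trans (le_of_eq ?_)
  have : b - a ≠ 0 := by linarith
  simp only [smul_eq_mul]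
  field_simp
  ring

/-- cell bound, convex case -/
lemma cell_convex (α β x a b : ℝ) (h1 : α < 1) (hβ1 : 1 ≤ β)
    (ha : 0 ≤ a) (hab : a < b) (hbx : b ≤ x) :
    ∫ s in a..b, omegaK (1 - α) (x - s) * omegaK β s ≤
      ((1 / (b - a)) * ∫ s in a..b, omegaK (1 - α) (x - s)) *
        (omegaK β b * (b - a)) := by
  have hI1 : IntervalIntegrable (fun s => omegaK (1 - α) (x - s) * omegaK β s)
      MeasureTheory.volume a b := by
    refine (omega_conv_int α β x h1 (by linarith) (by linarith)).mono_set ?_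
    rw [Set.uIcc_of_le hab.le, Set.uIcc_of_le (by linarith)]
    exact Set.Icc_subset_Icc ha hbx
  have hI2 := omega_int' (1 - α) a b x (by linarith)
  have key : ∫ s in a..b, omegaK (1 - α) (x - s) * omegaK β s ≤
      ∫ s in a..b, omegaK β b * omegaK (1 - α) (x - s) := by
    refine intervalIntegral.integral_mono_on_of_le_Ioo hab.le hI1 (hI2.const_mul _) ?_
    intro s hs
    have e := omega_mono β s b hβ1 (by linarith [hs.1]) hs.2.le
    have := omega_pos (1 - α) (x - s) (by linarith) (by linarith [hs.2])
    rw [mul_comm]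
    gcongr
  rw [intervalIntegral.integral_const_mul] at key
  refine key.trans (le_of_eq ?_)
  have : b - a ≠ 0 := by linarith
  field_simp

lemma omega_step_convex (β a b : ℝ) (hβ1 : 1 ≤ β) (ha : 0 ≤ a) (hab : a ≤ b) :
    omegaK β a * (b - a) ≤ omegaK (β + 1) b - omegaK (β + 1) a := by
  rw [← omega_integral β a b (by linarith)]
  have : ∫ s in a..b, omegaK β a ≤ ∫ s in a..b, omegaK β s := by
    refine intervalIntegral.integral_mono_on hab intervalIntegrable_const
      (omega_int β a b (by linarith)) ?_
    intro s hs
    exact omega_mono β a s hβ1 ha hs.1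
  simpa [mul_comm] using this

lemma Gamma_lower (R x : ℝ) (hR : 0 < R) (hx : 1 ≤ x) :
    Real.exp (-R) * R ^ (x - 1) ≤ Real.Gamma x := by
  rw [Real.Gamma_eq_integral (by linarith), ← integral_exp_neg_Ioi R,
    ← MeasureTheory.integral_mul_const]
  have hG := Real.GammaIntegral_convergent (show 0 < x by linarith)
  have hs : Set.Ioi R ⊆ Set.Ioi (0:ℝ) := Set.Ioi_subset_Ioi hR.le
  calc ∫ s in Set.Ioi R, Real.exp (-s) * R ^ (x - 1)
      ≤ ∫ s in Set.Ioi R, Real.exp (-s) * s ^ (x - 1) := by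
        refine MeasureTheory.setIntegral_mono_on ?_ (hG.mono_set hs) measurableSet_Ioi ?_
        · exact (integrableOn_exp_neg_Ioi R).mul_const _
        · intro s hs
          have : R ≤ s := le_of_lt hs
          gcongr
    _ ≤ ∫ s in Set.Ioi 0, Real.exp (-s) * s ^ (x - 1) := by
        refine MeasureTheory.setIntegral_mono_set hG ?_ hs.eventuallyLE
        refine (MeasureTheory.ae_restrict_iff' measurableSet_Ioi).2 (Filter.Eventually.of_forall ?_)
        intro s hs
        have : (0:ℝ) < s := hs
        simp only [Pi.zero_apply]
        positivity

lemma ml_summable (α z : ℝ) (hα : 0 < α) (hz : 0 ≤ z) :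
    Summable (fun k : ℕ => z ^ k / Real.Gamma (1 + k * α)) := by
  set R : ℝ := (2 * z + 1) ^ (1 / α) with hR
  have hRpos : 0 < R := Real.rpow_pos_of_pos (by linarith) _
  have hRα : R ^ α = 2 * z + 1 := by
    rw [hR, ← Real.rpow_mul (by linarith)]
    field_simp
    simp
  have hgeo : Summable (fun k : ℕ => Real.exp R * (z / (2 * z + 1)) ^ k) := by
    refine (summable_geometric_of_lt_one (by positivity) ?_).mul_left _
    rw [div_lt_one (by linarith)]
    linarith
  refine Summable.of_nonneg_of_le ?_ ?_ hgeo
  · intro k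
    have := Real.Gamma_pos_of_pos (show 0 < 1 + k * α by positivity)
    positivity
  · intro k
    have h := Gamma_lower R (1 + k * α) hRpos (by simp; positivity)
    have e : R ^ (1 + k * α - 1) = (2 * z + 1) ^ k := by
      rw [← hRα, ← Real.rpow_natCast, ← Real.rpow_mul hRpos.le]
      congr 1
      ring
    rw [e] at h
    calc z ^ k / Real.Gamma (1 + k * α) ≤ z ^ k / (Real.exp (-R) * (2 * z + 1) ^ k) := by
          gcongr
      _ = _ := by
          rw [Real.exp_neg, div_pow]
          field_simp

lemma t_lt {N : ℕ} {t : ℕ → ℝ} (hm : ∀ k, k < N → t k < t (k + 1)) {i j : ℕ} (hij : i < j)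
    (hj : j ≤ N) : t i < t j := by
  induction j, hij using Nat.le_induction with
  | base => exact hm i (by omega)
  | succ m _ ih => exact (ih (by omega)).trans (hm m (by omega))

lemma t_le {N : ℕ} {t : ℕ → ℝ} (hm : ∀ k, k < N → t k < t (k + 1)) {i j : ℕ} (hij : i ≤ j)
    (hj : j ≤ N) : t i ≤ t j := by
  rcases hij.eq_or_lt with h | h
  · rw [h]
  · exact (t_lt hm h hj).le

lemma a_pos {N : ℕ} {t : ℕ → ℝ} (hm : ∀ k, k < N → t k < t (k + 1)) {α : ℝ} (h1 : α < 1)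
    {n k : ℕ} (hk : 1 ≤ k) (hkn : k ≤ n) (hn : n ≤ N) : 0 < aK α t n k := by
  rw [a_explicit α h1]
  have e1 := t_lt hm (show k - 1 < k by omega) (hkn.trans hn)
  have e2 := t_le hm hkn hn
  refine div_pos ?_ (by linarith)
  unfold omegaK
  have g := Real.Gamma_pos_of_pos (show 0 < 1 - α + 1 by linarith)
  rw [← sub_div]
  refine div_pos ?_ g
  rw [sub_pos]
  exact Real.rpow_lt_rpow (by linarith) (by linarith) (by linarith)

lemma a_mono {N : ℕ} {t : ℕ → ℝ} (hm : ∀ k, k < N → t k < t (k + 1)) {α : ℝ} (h0 : 0 < α)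
    (h1 : α < 1) {n k : ℕ} (hk : 1 ≤ k) (hkn : k + 1 ≤ n) (hn : n ≤ N) :
    aK α t n k ≤ aK α t n (k + 1) := by
  rw [a_explicit α h1, a_explicit α h1]
  have e1 := t_lt hm (show k - 1 < k by omega) (show k ≤ N by omega)
  have e2 := t_lt hm (show k < k + 1 by omega) (show k + 1 ≤ N by omega)
  have e3 := t_le hm hkn hn
  simp only [Nat.add_sub_cancel]
  have hc := Real.concaveOn_rpow (p := 1 - α) (by linarith) (by linarith)
  have := hc.slope_anti_adjacent (x := t n - t (k + 1)) (y := t n - t k) (z := t n - t (k - 1))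
    (by simp; linarith) (by simp; linarith) (by linarith) (by linarith)
  have g := Real.Gamma_pos_of_pos (show 0 < 1 - α + 1 by linarith)
  unfold omegaK
  simp only [add_sub_cancel_right]
  rw [← sub_div, ← sub_div, div_right_comm, div_right_comm _ (Real.Gamma _)]
  gcongr ?_ / _
  simpa using this

lemma p_rec (α : ℝ) (t : ℕ → ℝ) (n k : ℕ) (hkn : k < n) :
    pK α t n (n - k) = (1 / aK α t k k) *
      ∑ j ∈ Finset.Icc (k + 1) n, (aK α t j (k + 1) - aK α t j k) * pK α t n (n - j) := by
  obtain ⟨m, rfl⟩ : ∃ m, n = k + 1 + m := ⟨n - k - 1, by omega⟩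
  rw [show k + 1 + m - k = m + 1 by omega, pK]
  rw [show k + 1 + m - m - 1 = k by omega, show k + 1 + m - m = k + 1 by omega]
  congr 1
  rw [Finset.sum_attach (Finset.range (m + 1)) (fun i =>
    (aK α t (k + 1 + m - i) (k + 1) - aK α t (k + 1 + m - i) k) * pK α t (k + 1 + m) i)]
  refine Finset.sum_bij' (fun i _ => k + 1 + m - i) (fun j _ => k + 1 + m - j) ?_ ?_ ?_ ?_ ?_
  · intro i hi; simp at hi ⊢; omega
  · intro i hi; simp at hi ⊢; omega
  · intro i hi; simp at hi ⊢; omega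
  · intro i hi; simp at hi ⊢; omega
  · intro i hi
    simp at hi
    rw [show k + 1 + m - (k + 1 + m - i) = i by omega]

lemma p_nonneg {N : ℕ} {t : ℕ → ℝ} (hm : ∀ k, k < N → t k < t (k + 1)) {α : ℝ} (h0 : 0 < α)
    (h1 : α < 1) {n : ℕ} (hn : n ≤ N) :
    ∀ m : ℕ, ∀ k, 1 ≤ k → k ≤ n → n - k = m → 0 ≤ pK α t n (n - k) := by
  intro m
  induction m using Nat.strong_induction_on with
  | _ m ih =>
    intro k hk hkn hkm
    rcases hkn.eq_or_lt with h | h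
    · subst h
      rw [Nat.sub_self, pK]
      exact (one_div_pos.2 (a_pos hm h1 hk le_rfl hn)).le
    · rw [p_rec α t n k h]
      refine mul_nonneg (one_div_pos.2 (a_pos hm h1 hk le_rfl (by omega))).le ?_
      refine Finset.sum_nonneg ?_
      intro j hj
      rw [Finset.mem_Icc] at hj
      refine mul_nonneg ?_ (ih (n - j) (by omega) j (by omega) hj.2 rfl)
      have := a_mono hm h0 h1 hk hj.1 (hj.2.trans hn)
      linarith

lemma p_compl {N : ℕ} {t : ℕ → ℝ} (hm : ∀ k, k < N → t k < t (k + 1)) {α : ℝ}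
    (h1 : α < 1) {n : ℕ} (hn : n ≤ N) :
    ∀ m : ℕ, ∀ k, 1 ≤ k → k ≤ n → n - k = m →
      ∑ j ∈ Finset.Icc k n, pK α t n (n - j) * aK α t j k = 1 := by
  intro m
  induction m with
  | zero =>
    intro k hk hkn hkm
    obtain rfl : k = n := by omega
    have := a_pos hm h1 hk le_rfl hn
    simp only [Finset.Icc_self, Finset.sum_singleton, Nat.sub_self, pK]
    field_simp
  | succ m ih =>
    intro k hk hkn hkm
    have hlt : k < n := by omega
    have ha := a_pos hm h1 hk le_rfl (by omega)
    rw [← Finset.add_sum_Ioc_eq_sum_Icc hkn, p_rec α t n k hlt]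
    have hIoc : Finset.Ioc k n = Finset.Icc (k + 1) n := by
      ext; simp only [Finset.mem_Ioc, Finset.mem_Icc]; omega
    rw [hIoc]
    refine Eq.trans ?_ (ih (k + 1) (by omega) (by omega) (by omega))
    rw [mul_comm (1 / _), mul_assoc,
      one_div_mul_cancel ha.ne', mul_one, ← Finset.sum_add_distrib]
    refine Finset.sum_congr rfl ?_
    intro j _
    ring

lemma sum_swap (M : ℕ) (q : ℕ → ℝ) (a : ℕ → ℕ → ℝ) (c : ℕ → ℝ) :
    ∑ j ∈ Finset.Icc 1 M, q j * ∑ k ∈ Finset.Icc 1 j, a j k * c k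
      = ∑ k ∈ Finset.Icc 1 M, c k * ∑ j ∈ Finset.Icc k M, q j * a j k := by
  simp only [Finset.mul_sum]
  rw [Finset.sum_comm' (t' := Finset.Icc 1 M) (s' := fun k => Finset.Icc k M)]
  · refine Finset.sum_congr rfl fun k _ => Finset.sum_congr rfl fun j _ => by ring
  · intro x y
    simp
    omega

lemma sum_tele (f : ℕ → ℝ) (n : ℕ) : ∑ k ∈ Finset.Icc 1 n, (f k - f (k - 1)) = f n - f 0 := by
  induction n with
  | zero => simp
  | succ n ih =>
    rw [Finset.sum_Icc_succ_top (by omega), ih]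
    simp

/-- general comparison -/
lemma p_omega_general {N : ℕ} {t : ℕ → ℝ} (ht0 : t 0 = 0)
    (hm : ∀ k, k < N → t k < t (k + 1)) {α : ℝ} (h0 : 0 < α)
    (h1 : α < 1) {n M : ℕ} (hn : n ≤ N) (hM : M ≤ n) (β : ℝ) (hβ : 0 < β) (c : ℕ → ℝ)
    (hc0 : ∀ k, 1 ≤ k → k ≤ M → 0 ≤ c k)
    (hc : ∀ j k, 1 ≤ k → k ≤ j → j ≤ M →
      ∫ s in (t (k - 1))..(t k), omegaK (1 - α) (t j - s) * omegaK β s ≤ aK α t j k * c k) :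
    ∑ j ∈ Finset.Icc 1 M, pK α t n (n - j) * omegaK (1 - α + β) (t j)
      ≤ ∑ k ∈ Finset.Icc 1 M, c k := by
  have hq : ∀ j, 1 ≤ j → j ≤ n → 0 ≤ pK α t n (n - j) := fun j h h' =>
    p_nonneg hm h0 h1 hn _ j h h' rfl
  calc ∑ j ∈ Finset.Icc 1 M, pK α t n (n - j) * omegaK (1 - α + β) (t j)
      ≤ ∑ j ∈ Finset.Icc 1 M, pK α t n (n - j) * ∑ k ∈ Finset.Icc 1 j, aK α t j k * c k := by
        refine Finset.sum_le_sum ?_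
        intro j hj
        rw [Finset.mem_Icc] at hj
        refine mul_le_mul_of_nonneg_left ?_ (hq j hj.1 (by omega))
        have htj : 0 < t j := by
          rw [← ht0]; exact t_lt hm (by omega) (by omega)
        have hsum := intervalIntegral.sum_integral_adjacent_intervals (a := t) (n := j)
          (f := fun s => omegaK (1 - α) (t j - s) * omegaK β s) (μ := MeasureTheory.volume)
          (by
            intro k hk
            refine (omega_conv_int α β (t j) h1 hβ htj).mono_set ?_
            have e1 := t_le hm (show k ≤ k + 1 by omega) (by omega)
            have e2 := t_le hm (show k + 1 ≤ j by omega) (by omega)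
            have e3 := t_le hm (show 0 ≤ k by omega) (by omega)
            rw [Set.uIcc_of_le e1, Set.uIcc_of_le htj.le]
            exact Set.Icc_subset_Icc (by linarith) e2)
        rw [ht0, omega_conv α β (t j) h1 hβ htj] at hsum
        rw [← hsum, Finset.range_eq_Ico, Finset.sum_Ico_eq_sum_range]
        have : Finset.Icc 1 j = Finset.Ico 1 (j + 1) := by ext; simp
        rw [this, Finset.sum_Ico_eq_sum_range]
        simp only [Nat.sub_zero, Nat.add_sub_cancel, zero_add]
        refine Finset.sum_le_sum ?_
        intro k hk
        rw [Finset.mem_range] at hk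
        have := hc j (1 + k) (by omega) (by omega) hj.2
        simpa [add_comm] using this
    _ = ∑ k ∈ Finset.Icc 1 M, c k * ∑ j ∈ Finset.Icc k M, pK α t n (n - j) * aK α t j k :=
        sum_swap M (fun j => pK α t n (n - j)) (fun j k => aK α t j k) c
    _ ≤ ∑ k ∈ Finset.Icc 1 M, c k := by
        refine Finset.sum_le_sum ?_
        intro k hk
        rw [Finset.mem_Icc] at hk
        refine mul_le_of_le_one_right (hc0 k hk.1 hk.2) ?_
        rw [← p_compl hm h1 hn _ k hk.1 (by omega) rfl]
        refine Finset.sum_le_sum_of_subset_of_nonneg (Finset.Icc_subset_Icc le_rfl hM) ?_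
        intro j hj _
        rw [Finset.mem_Icc] at hj
        exact mul_nonneg (hq j (by omega) hj.2) (a_pos hm h1 hk.1 hj.1 (by omega)).le

lemma p_omega_concave {N : ℕ} {t : ℕ → ℝ} (ht0 : t 0 = 0)
    (hm : ∀ k, k < N → t k < t (k + 1)) {α : ℝ} (h0 : 0 < α)
    (h1 : α < 1) {n M : ℕ} (hn : n ≤ N) (hM : M ≤ n) (β : ℝ) (hβ : 0 < β) (hβ1 : β ≤ 1) :
    ∑ j ∈ Finset.Icc 1 M, pK α t n (n - j) * omegaK (1 - α + β) (t j)
      ≤ omegaK (β + 1) (t M) := by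
  have h := p_omega_general ht0 hm h0 h1 hn hM β hβ
    (fun k => omegaK (β + 1) (t k) - omegaK (β + 1) (t (k - 1))) ?_ ?_
  · rw [sum_tele (fun k => omegaK (β + 1) (t k))] at h
    refine h.trans ?_
    have : 0 ≤ omegaK (β + 1) (t 0) := by
      rw [ht0]
      unfold omegaK
      rw [Real.zero_rpow (by linarith)]
      simp
    linarith
  · intro k hk hkM
    have e1 := t_le hm (show k - 1 ≤ k by omega) (by omega)
    have e3 := t_le hm (show 0 ≤ k - 1 by omega) (by omega)
    have := omega_mono (β + 1) _ _ (by linarith) (by linarith) e1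
    linarith
  · intro j k hk hkj hjM
    have e1 := t_lt hm (show k - 1 < k by omega) (by omega)
    have e2 := t_le hm hkj (by omega)
    have e3 := t_le hm (show 0 ≤ k - 1 by omega) (by omega)
    exact cell_concave α β (t j) _ _ h1 h0 hβ hβ1 (by linarith) e1 e2

lemma p_omega_convex {N : ℕ} {t : ℕ → ℝ} (ht0 : t 0 = 0)
    (hm : ∀ k, k < N → t k < t (k + 1)) {α : ℝ} (h0 : 0 < α)
    (h1 : α < 1) {M : ℕ} (hn : M + 1 ≤ N) (β : ℝ) (hβ1 : 1 ≤ β) (r : ℝ) (hr : 0 < r)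
    (hratio : ∀ k, 1 ≤ k → k + 1 ≤ N → r * (t k - t (k - 1)) ≤ t (k + 1) - t k) :
    ∑ j ∈ Finset.Icc 1 M, pK α t (M + 1) (M + 1 - j) * omegaK (1 - α + β) (t j)
      ≤ omegaK (β + 1) (t (M + 1)) / r := by
  have h := p_omega_general ht0 hm h0 h1 hn (Nat.le_succ M) β (by linarith)
    (fun k => omegaK β (t k) * (t k - t (k - 1))) ?_ ?_
  · refine h.trans ?_
    rw [le_div_iff₀ hr, Finset.sum_mul]
    have hstep : ∀ k ∈ Finset.Icc 1 M, omegaK β (t k) * (t k - t (k - 1)) * r ≤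
        omegaK (β + 1) (t (k + 1)) - omegaK (β + 1) (t (k - 1 + 1)) := by
      intro k hk
      rw [Finset.mem_Icc] at hk
      rw [Nat.sub_add_cancel hk.1]
      have e1 := t_le hm (show k ≤ k + 1 by omega) (by omega)
      have e3 := t_lt hm (show 0 < k by omega) (by omega)
      have e4 := omega_step_convex β (t k) (t (k + 1)) hβ1 (by linarith) e1
      have e5 := hratio k hk.1 (by omega)
      have e6 := omega_pos β (t k) (by linarith) (by linarith)
      refine le_trans ?_ e4
      rw [mul_assoc]
      gcongr
      linarith
    refine (Finset.sum_le_sum hstep).trans ?_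
    rw [sum_tele (fun k => omegaK (β + 1) (t (k + 1)))]
    have e3 := t_lt hm (show 0 < 0 + 1 by omega) (by omega)
    have := omega_pos (β + 1) (t (0 + 1)) (by linarith) (by linarith)
    linarith
  · intro k hk hkM
    have e1 := t_lt hm (show k - 1 < k by omega) (by omega)
    have e3 := t_lt hm (show 0 < k by omega) (by omega)
    exact mul_nonneg (omega_pos β (t k) (by linarith) (by linarith)).le (by linarith)
  · intro j k hk hkj hjM
    have e1 := t_lt hm (show k - 1 < k by omega) (by omega)
    have e2 := t_le hm hkj (by omega)
    have e3 := t_le hm (show 0 ≤ k - 1 by omega) (by omega)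
    exact cell_convex α β (t j) _ _ h1 hβ1 (by linarith) e1 e2

lemma p_omega_any {N : ℕ} {t : ℕ → ℝ} (ht0 : t 0 = 0)
    (hm : ∀ k, k < N → t k < t (k + 1)) {α : ℝ} (h0 : 0 < α)
    (h1 : α < 1) {M : ℕ} (hn : M + 1 ≤ N) (β : ℝ) (hβ : 0 < β) (r : ℝ) (hr : 0 < r)
    (hr1 : r ≤ 1)
    (hratio : ∀ k, 1 ≤ k → k + 1 ≤ N → r * (t k - t (k - 1)) ≤ t (k + 1) - t k) :
    ∑ j ∈ Finset.Icc 1 M, pK α t (M + 1) (M + 1 - j) * omegaK (1 - α + β) (t j)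
      ≤ omegaK (β + 1) (t (M + 1)) / r := by
  rcases le_total β 1 with h | h
  · refine (p_omega_concave ht0 hm h0 h1 hn (Nat.le_succ M) β hβ h).trans ?_
    have e1 := t_le hm (show M ≤ M + 1 by omega) hn
    have e2 := t_le hm (show 0 ≤ M by omega) (by omega)
    have e3 := t_lt hm (show 0 < M + 1 by omega) (by omega)
    have e4 := omega_mono (β + 1) _ _ (by linarith) (by linarith) e1
    have e5 := omega_pos (β + 1) (t (M + 1)) (by linarith) (by linarith)
    refine e4.trans ?_
    rw [le_div_iff₀ hr]
    exact mul_le_of_le_one_right e5.le hr1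
  · exact p_omega_convex ht0 hm h0 h1 hn β h r hr hratio

lemma ratio_facts {N : ℕ} {t : ℕ → ℝ} (hm : ∀ k, k < N → t k < t (k + 1)) :
    0 < minStepRatio t N ∧ minStepRatio t N ≤ 1 ∧
    ∀ k, 1 ≤ k → k + 1 ≤ N → minStepRatio t N * (t k - t (k - 1)) ≤ t (k + 1) - t k := by
  set S : Set ℝ := insert 1
    ((fun k : ℕ => (t k - t (k - 1)) / (t (k - 1) - t (k - 2))) '' Set.Icc 2 N) with hS
  have hfin : S.Finite := ((Set.finite_Icc 2 N).image _).insert 1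
  have hne : S.Nonempty := ⟨1, Set.mem_insert _ _⟩
  have hmem : sInf S ∈ S := hne.csInf_mem hfin
  have hpos : ∀ x ∈ S, 0 < x := by
    intro x hx
    rcases hx with rfl | ⟨k, hk, rfl⟩
    · exact one_pos
    · have hk1 := hk.1
      have hk2 := hk.2
      have e1 := t_lt hm (show k - 1 < k by omega) hk2
      have e2 := t_lt hm (show k - 2 < k - 1 by omega) (by omega)
      exact div_pos (by linarith) (by linarith)
  refine ⟨hpos _ hmem, csInf_le hfin.bddBelow (Set.mem_insert _ _), ?_⟩
  intro k hk hkN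
  have e2 := t_lt hm (show k - 1 < k by omega) (by omega)
  have : minStepRatio t N ≤ (t (k + 1) - t k) / (t k - t (k - 1)) := by
    refine csInf_le hfin.bddBelow (Set.mem_insert_of_mem _ ⟨k + 1, ⟨by omega, hkN⟩, ?_⟩)
    simp only [Nat.add_sub_cancel, show k + 1 - 2 = k - 1 by omega]
  rwa [le_div_iff₀ (by linarith)] at this

lemma ml_ge_one (α z : ℝ) (hα : 0 < α) (hz : 0 ≤ z) : 1 ≤ mittagLeffler α z := by
  have h := (ml_summable α z hα hz).le_tsum 0 (by
    intro k _
    have := Real.Gamma_pos_of_pos (show 0 < 1 + k * α by positivity)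
    positivity)
  simpa [mittagLeffler] using h

/-- key Mittag-Leffler estimate -/
lemma p_ml {N : ℕ} {t : ℕ → ℝ} (ht0 : t 0 = 0)
    (hm : ∀ k, k < N → t k < t (k + 1)) {α : ℝ} (h0 : 0 < α)
    (h1 : α < 1) {M : ℕ} (hn : M + 1 ≤ N) (r : ℝ) (hr : 0 < r)
    (hr1 : r ≤ 1)
    (hratio : ∀ k, 1 ≤ k → k + 1 ≤ N → r * (t k - t (k - 1)) ≤ t (k + 1) - t k)
    (μ : ℝ) (hμ : 0 < μ) :
    μ * r * ∑ j ∈ Finset.Icc 1 M, pK α t (M + 1) (M + 1 - j) * mittagLeffler α (μ * t j ^ α)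
      ≤ mittagLeffler α (μ * t (M + 1) ^ α) - 1 := by
  have hterm : ∀ x : ℝ, 0 < x → ∀ m : ℕ, (μ * x ^ α) ^ m / Real.Gamma (1 + m * α) =
      μ ^ m * omegaK (1 + m * α) x := by
    intro x hx m
    unfold omegaK
    rw [mul_pow, ← Real.rpow_natCast (x ^ α) m, ← Real.rpow_mul hx.le, mul_div_assoc]
    congr 3
    ring
  have hpos : ∀ j, 1 ≤ j → j ≤ N → 0 < t j := by
    intro j hj hjN
    rw [← ht0]; exact t_lt hm (by omega) hjN
  have hsum : ∀ j, 1 ≤ j → j ≤ N → Summable (fun m : ℕ => μ ^ m * omegaK (1 + m * α) (t j)) := by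
    intro j hj hjN
    have := ml_summable α (μ * t j ^ α) h0 (by have := hpos j hj hjN; positivity)
    simpa only [hterm (t j) (hpos j hj hjN)] using this
  have hml : ∀ j, 1 ≤ j → j ≤ N → mittagLeffler α (μ * t j ^ α) =
      ∑' m : ℕ, μ ^ m * omegaK (1 + m * α) (t j) := by
    intro j hj hjN
    unfold mittagLeffler
    simp only [hterm (t j) (hpos j hj hjN)]
  have hS := hsum (M + 1) (by omega) hn
  rw [hml (M + 1) (by omega) hn, hS.tsum_eq_zero_add]
  have hz : μ ^ 0 * omegaK (1 + (0 : ℕ) * α) (t (M + 1)) = 1 := by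
    simp [omegaK]
  rw [hz, add_sub_cancel_left]
  have hL : ∀ j ∈ Finset.Icc 1 M,
      HasSum (fun m : ℕ => pK α t (M + 1) (M + 1 - j) * (μ ^ m * omegaK (1 + m * α) (t j)))
        (pK α t (M + 1) (M + 1 - j) * mittagLeffler α (μ * t j ^ α)) := by
    intro j hj
    rw [Finset.mem_Icc] at hj
    rw [hml j hj.1 (by omega)]
    exact (hsum j hj.1 (by omega)).hasSum.mul_left _
  have hL2 := (hasSum_sum hL).mul_left (μ * r)
  have hR := ((summable_nat_add_iff 1).2 hS).hasSum
  refine hasSum_le ?_ hL2 hR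
  intro m
  have h := p_omega_any ht0 hm h0 h1 hn ((m + 1 : ℕ) * α) (by positivity) r hr hr1 hratio
  rw [le_div_iff₀ hr] at h
  have e1 : (1 - α + ((m + 1 : ℕ) : ℝ) * α) = 1 + m * α := by push_cast; ring
  rw [e1, add_comm _ (1 : ℝ)] at h
  have e2 : μ * r * ∑ j ∈ Finset.Icc 1 M,
      pK α t (M + 1) (M + 1 - j) * (μ ^ m * omegaK (1 + m * α) (t j)) =
      μ ^ (m + 1) * ((∑ j ∈ Finset.Icc 1 M,
        pK α t (M + 1) (M + 1 - j) * omegaK (1 + m * α) (t j)) * r) := by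
    rw [Finset.sum_mul, Finset.mul_sum, Finset.mul_sum]
    refine Finset.sum_congr rfl fun j _ => by ring
  rw [e2]
  gcongr

/-- discrete fractional Grönwall inequality: if `τ^α ≤ 1/(2Γ(2-α)ρ)` and the
nonnegative reals satisfy `Σ_{k=1}^n a^{(n)}_{n-k}(v_k - v_{k-1}) ≤ ρ v_n + ξ_n + η_n`, then
`v_n ≤ 2E_α(2ρt_n^α/r*)(v_0 + max_{1≤k≤n} Σ_{j=1}^k p^{(k)}_{k-j} ξ_j + ω_{1+α}(t_n) max_{1≤j≤n} η_j)`. -/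
theorem discrete_fractional_Gronwall
    (N : ℕ) (α T : ℝ) (hα : 0 < α ∧ α < 1)
    (t : ℕ → ℝ) (ht0 : t 0 = 0) (htN : t N = T)
    (htmono : ∀ k, k < N → t k < t (k + 1))
    (ρ : ℝ) (hρ : 0 < ρ)
    (hτ : ∀ k, 1 ≤ k → k ≤ N →
      (t k - t (k - 1)) ^ α ≤ 1 / (2 * Real.Gamma (2 - α) * ρ))
    (v ξ η : ℕ → ℝ)
    (hv : ∀ n, 0 ≤ v n) (hξ : ∀ n, 0 ≤ ξ n) (hη : ∀ n, 0 ≤ η n)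
    (hrec : ∀ n, 1 ≤ n → n ≤ N →
      ∑ k ∈ Finset.Icc 1 n, aK α t n k * (v k - v (k - 1)) ≤ ρ * v n + ξ n + η n) :
    ∀ n, ∀ hn1 : 1 ≤ n, n ≤ N →
      v n ≤ 2 * mittagLeffler α (2 * ρ * (t n) ^ α / minStepRatio t N) *
        (v 0
          + (Finset.Icc 1 n).sup' (Finset.nonempty_Icc.mpr hn1)
              (fun k => ∑ j ∈ Finset.Icc 1 k, pK α t k (k - j) * ξ j)
          + omegaK (1 + α) (t n) *
              (Finset.Icc 1 n).sup' (Finset.nonempty_Icc.mpr hn1) η) := by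
  obtain ⟨h0, h1⟩ := hα
  obtain ⟨hr, hr1, hratio⟩ := ratio_facts htmono
  set r := minStepRatio t N with hrdef
  have hE : ∀ n, 2 * ρ * (t n) ^ α / r = (2 * ρ / r) * (t n) ^ α := fun n => by ring
  have hμ : 0 < 2 * ρ / r := by positivity
  have hpos : ∀ j, 1 ≤ j → j ≤ N → 0 < t j := by
    intro j hj hjN
    rw [← ht0]; exact t_lt htmono (by omega) hjN
  intro n
  induction n using Nat.strong_induction_on with
  | _ n ih =>
    intro hn1 hnN
    obtain ⟨M, rfl⟩ : ∃ M, n = M + 1 := ⟨n - 1, by omega⟩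
    have hq : ∀ j, 1 ≤ j → j ≤ M + 1 → 0 ≤ pK α t (M + 1) (M + 1 - j) := fun j h h' =>
      p_nonneg htmono h0 h1 hnN _ j h h' rfl
    set X := (Finset.Icc 1 (M + 1)).sup' (Finset.nonempty_Icc.mpr hn1)
      (fun k => ∑ j ∈ Finset.Icc 1 k, pK α t k (k - j) * ξ j) with hX
    set H := (Finset.Icc 1 (M + 1)).sup' (Finset.nonempty_Icc.mpr hn1) η with hH
    have htn := hpos (M + 1) hn1 hnN
    have hH0 : 0 ≤ H := (hη (M + 1)).trans
      (Finset.le_sup' η (Finset.mem_Icc.2 ⟨hn1, le_rfl⟩))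
    have hX1 : ∑ j ∈ Finset.Icc 1 (M + 1), pK α t (M + 1) (M + 1 - j) * ξ j ≤ X :=
      Finset.le_sup' (fun k => ∑ j ∈ Finset.Icc 1 k, pK α t k (k - j) * ξ j)
        (Finset.mem_Icc.2 ⟨hn1, le_rfl⟩)
    have hX0 : 0 ≤ X := by
      refine le_trans (Finset.sum_nonneg ?_) hX1
      intro j hj
      rw [Finset.mem_Icc] at hj
      exact mul_nonneg (hq j hj.1 hj.2) (hξ j)
    have hω := omega_pos (1 + α) (t (M + 1)) (by linarith) htn
    set Ψ := v 0 + X + omegaK (1 + α) (t (M + 1)) * H with hΨ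
    have hΨ0 : 0 ≤ Ψ := by
      have := hv 0
      positivity
    -- induction hypothesis in usable form
    have ihv : ∀ j ∈ Finset.Icc 1 M, v j ≤ 2 * mittagLeffler α ((2 * ρ / r) * (t j) ^ α) * Ψ := by
      intro j hj
      rw [Finset.mem_Icc] at hj
      have h := ih j (by omega) hj.1 (by omega)
      rw [hE] at h
      refine h.trans ?_
      have htj := hpos j hj.1 (by omega)
      have hm1 := ml_ge_one α ((2 * ρ / r) * (t j) ^ α) h0 (by positivity)
      have hsub : Finset.Icc 1 j ⊆ Finset.Icc 1 (M + 1) := Finset.Icc_subset_Icc le_rfl (by omega)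
      have hjη : 0 ≤ (Finset.Icc 1 j).sup' (Finset.nonempty_Icc.mpr hj.1) η := (hη j).trans
        (Finset.le_sup' η (Finset.mem_Icc.2 ⟨hj.1, le_rfl⟩))
      have hsX := Finset.sup'_mono (fun k => ∑ j ∈ Finset.Icc 1 k, pK α t k (k - j) * ξ j) hsub
        (Finset.nonempty_Icc.mpr hj.1)
      have hsH := Finset.sup'_mono η hsub (Finset.nonempty_Icc.mpr hj.1)
      have hom := omega_mono (1 + α) _ _ (by linarith) htj.le
        (t_le htmono (show j ≤ M + 1 by omega) hnN)
      refine mul_le_mul_of_nonneg_left ?_ (by linarith)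
      rw [hΨ]
      refine add_le_add (add_le_add le_rfl hsX) ?_
      exact mul_le_mul hom hsH hjη hω.le
    -- apply the DCC kernels
    have hmain : v (M + 1) - v 0 ≤ ∑ j ∈ Finset.Icc 1 (M + 1), pK α t (M + 1) (M + 1 - j) *
        (ρ * v j + ξ j + η j) := by
      have e1 : ∑ j ∈ Finset.Icc 1 (M + 1), pK α t (M + 1) (M + 1 - j) *
          ∑ k ∈ Finset.Icc 1 j, aK α t j k * (v k - v (k - 1)) = v (M + 1) - v 0 := by
        rw [sum_swap (M + 1) (fun j => pK α t (M + 1) (M + 1 - j)) (fun j k => aK α t j k)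
          (fun k => v k - v (k - 1)), ← sum_tele v]
        refine Finset.sum_congr rfl ?_
        intro k hk
        rw [Finset.mem_Icc] at hk
        rw [p_compl htmono h1 hnN _ k hk.1 hk.2 rfl, mul_one]
      rw [← e1]
      refine Finset.sum_le_sum ?_
      intro j hj
      rw [Finset.mem_Icc] at hj
      exact mul_le_mul_of_nonneg_left (hrec j hj.1 (by omega)) (hq j hj.1 hj.2)
    have hsplit : ∑ j ∈ Finset.Icc 1 (M + 1), pK α t (M + 1) (M + 1 - j) *
        (ρ * v j + ξ j + η j) = ρ * ∑ j ∈ Finset.Icc 1 (M + 1), pK α t (M + 1) (M + 1 - j) * v j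
        + ∑ j ∈ Finset.Icc 1 (M + 1), pK α t (M + 1) (M + 1 - j) * ξ j
        + ∑ j ∈ Finset.Icc 1 (M + 1), pK α t (M + 1) (M + 1 - j) * η j := by
      rw [Finset.mul_sum, ← Finset.sum_add_distrib, ← Finset.sum_add_distrib]
      exact Finset.sum_congr rfl fun j _ => by ring
    have hηb : ∑ j ∈ Finset.Icc 1 (M + 1), pK α t (M + 1) (M + 1 - j) * η j ≤
        omegaK (1 + α) (t (M + 1)) * H := by
      have hp := p_omega_concave htmono (M := M + 1) (n := M + 1) (ht0 := ht0) h0 h1 hnN le_rfl α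
        h0 h1.le
      have e : ∀ x : ℝ, omegaK (1 - α + α) x = 1 := by
        intro x
        simp [omegaK]
      simp only [e, mul_one] at hp
      rw [add_comm α 1] at hp
      calc _ ≤ ∑ j ∈ Finset.Icc 1 (M + 1), pK α t (M + 1) (M + 1 - j) * H := by
            refine Finset.sum_le_sum ?_
            intro j hj
            have hj' := Finset.mem_Icc.1 hj
            exact mul_le_mul_of_nonneg_left (Finset.le_sup' η hj) (hq j hj'.1 hj'.2)
        _ ≤ _ := by
            rw [← Finset.sum_mul]
            exact mul_le_mul_of_nonneg_right hp hH0
    -- diagonal term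
    have hdiag : ρ * pK α t (M + 1) 0 ≤ 1 / 2 := by
      have hτM := hτ (M + 1) hn1 hnN
      have e1 := t_lt htmono (show M < M + 1 by omega) hnN
      have g := Real.Gamma_pos_of_pos (show 0 < 2 - α by linarith)
      simp only [Nat.add_sub_cancel] at hτM
      set d := t (M + 1) - t M with hd
      have hd0 : 0 < d := by rw [hd]; linarith
      have hp0 : pK α t (M + 1) 0 = Real.Gamma (2 - α) * d ^ α := by
        rw [pK, a_explicit α h1]
        simp only [Nat.add_sub_cancel, sub_self, ← hd]
        unfold omegaK
        rw [Real.zero_rpow (by linarith), show 1 - α + 1 = 2 - α by ring,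
          show 2 - α - 1 = 1 - α by ring, Real.rpow_sub hd0, Real.rpow_one]
        have := Real.rpow_pos_of_pos hd0 α
        have hd1 := hd0.ne'
        simp only [zero_div, sub_zero]
        field_simp
      rw [hp0]
      rw [le_div_iff₀ (by positivity)] at hτM
      linarith
    have hlast : ∑ j ∈ Finset.Icc 1 (M + 1), pK α t (M + 1) (M + 1 - j) * v j =
        ∑ j ∈ Finset.Icc 1 M, pK α t (M + 1) (M + 1 - j) * v j
          + pK α t (M + 1) 0 * v (M + 1) := by
      rw [Finset.sum_Icc_succ_top (by omega), Nat.sub_self]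
    rw [hlast] at hsplit
    have hdv := mul_le_mul_of_nonneg_right hdiag (hv (M + 1))
    -- the history term
    have hhist : ρ * ∑ j ∈ Finset.Icc 1 M, pK α t (M + 1) (M + 1 - j) * v j ≤
        Ψ * (mittagLeffler α ((2 * ρ / r) * (t (M + 1)) ^ α) - 1) := by
      have hk := p_ml ht0 htmono h0 h1 hnN r hr hr1 hratio (2 * ρ / r) hμ
      rw [div_mul_cancel₀ _ hr.ne'] at hk
      refine le_trans ?_ (mul_le_mul_of_nonneg_left hk hΨ0)
      rw [Finset.mul_sum, Finset.mul_sum, Finset.mul_sum]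
      refine Finset.sum_le_sum ?_
      intro j hj
      have hj' := Finset.mem_Icc.1 hj
      have := mul_le_mul_of_nonneg_left (ihv j hj) (mul_nonneg hρ.le (hq j hj'.1 (by omega)))
      linarith
    rw [hE]
    rw [hsplit] at hmain
    linarith
end
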